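/- arXiv:2510.05241 — 4 statements merged into one kernel-verified Lean document; each statement's English description precedes it below -/
import Mathlib

section
/- In the setting of the four-block learning-aware gap bound theorem (Assumption C, four-block iterates, conditions (i)–(iii)), suppose additionally that t_k ≤ 1 for all k, that the Bregman diameters R_x = sup_{x,x̄∈dom f} D_X(x,x̄), R_w = sup_{w,w̄∈W} D_W(w,w̄), R_y = sup_{y,ȳ∈dom h} D_Y(y,ȳ), R_θ = sup_{θ,θ̄∈Θ} D_Θ(θ,θ̄) are finite, that there are constants c₀, c₁ > 0 with B ≤ c₀/ε and |ℓ_{k+1} − ℓ*| ≤ c₁/(k+1)² for all k ≥ 0. Then for every K ≥ 1 and every x ∈ dom f, w ∈ W, y ∈ dom h, θ ∈ Θ: L(x̄_K, w̄_K, y, θ; ℓ*) − L(x, w, ȳ_K, θ̄_K; ℓ*) ≤ (1/T_K)·(R_x/τ₀ + R_w/τ₀ + R_y/σ₀ + R_θ/σ₀) + c₀c₁π²/(3 T_K ε). In particular, with ε = 1/√K the second term equals c₀c₁π²√K/(3 T_K). -/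
open RealInnerProductSpace

/-- A linear lower bound on the increments of `F` along a segment bounds its directional derivative
from below. -/
lemma le_inner_gradient_of_segment {E : Type*} [NormedAddCommGroup E] [InnerProductSpace ℝ E]
    [CompleteSpace E] {F : E → ℝ} {G z v : E} {c : ℝ} (hF : HasGradientAt F G z)
    (hc : ∀ s : ℝ, 0 < s → s ≤ 1 → s * c ≤ F (z + s • v) - F z) : c ≤ ⟪G, v⟫ := by
  have hline : HasDerivAt (fun s : ℝ => z + s • v) v 0 := by
    simpa using ((hasDerivAt_id (0 : ℝ)).smul_const v).const_add z
  have hz : HasFDerivAt F (InnerProductSpace.toDual ℝ E G) (z + (0 : ℝ) • v) := by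
    simpa using hF.hasFDerivAt
  have hderiv : HasDerivAt (fun s : ℝ => F (z + s • v)) ⟪G, v⟫ 0 := by
    simpa [Function.comp_def] using hz.comp_hasDerivAt (0 : ℝ) hline
  have hlim := (hasDerivAt_iff_tendsto_slope_zero.mp hderiv).mono_left
    (nhdsWithin_mono (0 : ℝ) (fun s (hs : s ∈ Set.Ioi 0) => ne_of_gt hs))
  refine ge_of_tendsto hlim ?_
  filter_upwards [Ioo_mem_nhdsGT (zero_lt_one' ℝ)] with s hs
  have hs' := hc s hs.1 hs.2.le
  simp only [zero_add, zero_smul, add_zero, smul_eq_mul]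
  rwa [inv_mul_eq_div, le_div_iff₀ hs.1, mul_comm]

lemma hasGradientAt_neg {E : Type*} [NormedAddCommGroup E] [InnerProductSpace ℝ E]
    [CompleteSpace E] {F : E → ℝ} {G z : E} (hF : HasGradientAt F G z) :
    HasGradientAt (-F) (-G) z := by
  rw [hasGradientAt_iff_hasFDerivAt, map_neg]
  exact hF.hasFDerivAt.neg

lemma ConvexOn.add_inner_gradient_le {E : Type*} [NormedAddCommGroup E] [InnerProductSpace ℝ E]
    [CompleteSpace E] {C : Set E} {F : E → ℝ} {G z z' : E} (hF : ConvexOn ℝ C F)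
    (hG : HasGradientAt F G z) (hz : z ∈ C) (hz' : z' ∈ C) : F z + ⟪G, z' - z⟫ ≤ F z' := by
  have h := le_inner_gradient_of_segment (v := z' - z) (c := F z - F z') (hasGradientAt_neg hG) ?_
  · rw [inner_neg_left] at h
    linarith
  · intro s hs hs1
    have := hF.2 hz hz' (sub_nonneg.2 hs1) hs.le (by ring)
    have hpt : (1 - s) • z + s • z' = z + s • (z' - z) := by module
    rw [hpt] at this
    simp only [smul_eq_mul, Pi.neg_apply] at this ⊢
    linarith

lemma ConcaveOn.le_add_inner_gradient {E : Type*} [NormedAddCommGroup E] [InnerProductSpace ℝ E]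
    [CompleteSpace E] {C : Set E} {F : E → ℝ} {G z z' : E} (hF : ConcaveOn ℝ C F)
    (hG : HasGradientAt F G z) (hz : z ∈ C) (hz' : z' ∈ C) : F z' ≤ F z + ⟪G, z' - z⟫ := by
  have h := hF.neg.add_inner_gradient_le (hasGradientAt_neg hG) hz hz'
  simp only [Pi.neg_apply, inner_neg_left] at h
  linarith

/-- The three-point inequality for a Bregman proximal step. -/
lemma bregman_prox_three_point {E : Type*} [NormedAddCommGroup E] [InnerProductSpace ℝ E]
    [CompleteSpace E] {C : Set E} {F φ : E → ℝ} {gφ : E → E} {D : E → E → ℝ}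
    (hF : ConvexOn ℝ C F) (hD : ∀ z z', D z z' = φ z - φ z' - ⟪gφ z', z - z'⟫)
    {z₀ z₁ z : E} (hz₁ : z₁ ∈ C) (hz : z ∈ C) (hφ : HasGradientAt φ (gφ z₁) z₁)
    {r : ℝ} (hr : 0 < r)
    (hmin : ∀ z' ∈ C, F z₁ + 1 / r * D z₁ z₀ ≤ F z' + 1 / r * D z' z₀) :
    F z₁ - F z ≤ 1 / r * (D z z₀ - D z z₁ - D z₁ z₀) := by
  have h := le_inner_gradient_of_segment (v := z - z₁)
    (c := r * (F z₁ - F z) + ⟪gφ z₀, z - z₁⟫) hφ ?_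
  · have hsplit : z - z₀ = (z - z₁) + (z₁ - z₀) := by abel
    rw [hD z z₀, hD z z₁, hD z₁ z₀, hsplit, inner_add_right, one_div, inv_mul_eq_div,
      le_div_iff₀ hr]
    linarith
  · intro s hs hs1
    have hconv := hF.2 hz₁ hz (sub_nonneg.2 hs1) hs.le (by ring)
    have hmem := hF.1 hz₁ hz (sub_nonneg.2 hs1) hs.le (by ring)
    have hpt : (1 - s) • z₁ + s • z = z₁ + s • (z - z₁) := by module
    rw [hpt] at hconv hmem
    have hm := mul_le_mul_of_nonneg_left (hmin _ hmem) hr.le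
    have hsplit : z₁ + s • (z - z₁) - z₀ = s • (z - z₁) + (z₁ - z₀) := by abel
    rw [hD, hD, hsplit, inner_add_right, inner_smul_right] at hm
    have hr1 : r * (1 / r) = 1 := by field_simp
    simp only [mul_add, ← mul_assoc, hr1, one_mul, smul_eq_mul] at hm hconv ⊢
    have := mul_le_mul_of_nonneg_left hconv hr.le
    linarith

lemma neg_inner_le_young {E : Type*} [NormedAddCommGroup E] [InnerProductSpace ℝ E]
    (a z : E) {α : ℝ} (hα : 0 < α) :
    -⟪a, z⟫ ≤ 1 / (2 * α) * ‖a‖ ^ 2 + α / 2 * ‖z‖ ^ 2 := by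
  have h := sq_nonneg ‖a + α • z‖
  rw [norm_add_sq_real, inner_smul_right, norm_smul, Real.norm_of_nonneg hα.le] at h
  have hdiv := div_nonneg h (by positivity : 0 ≤ 2 * α)
  have heq : (‖a‖ ^ 2 + 2 * (α * ⟪a, z⟫) + (α * ‖z‖) ^ 2) / (2 * α)
      = 1 / (2 * α) * ‖a‖ ^ 2 + ⟪a, z⟫ + α / 2 * ‖z‖ ^ 2 := by
    field_simp
  linarith

lemma neg_inner_add_le_young {E : Type*} [NormedAddCommGroup E] [InnerProductSpace ℝ E]
    (a b z : E) {α : ℝ} (hα : 0 < α) :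
    -⟪a + b, z⟫ ≤ 1 / α * ‖a‖ ^ 2 + 1 / α * ‖b‖ ^ 2 + α / 2 * ‖z‖ ^ 2 := by
  have ha := neg_inner_le_young a z (half_pos hα)
  have hb := neg_inner_le_young b z (half_pos hα)
  rw [show 2 * (α / 2) = α by ring] at ha hb
  rw [inner_add_left]
  linarith

/-- Weighted telescoping of the one-step estimates of a primal-dual method with momentum. -/
lemma weighted_sum_le_of_step {K : ℕ} {t τ σ η gap e J a b : ℕ → ℝ} {ρ : ℝ}
    (ht : ∀ k, 0 < t k) (ht0 : t 0 = 1)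
    (htτ : ∀ k, t (k + 1) / τ (k + 1) ≤ t k / τ k)
    (htσ : ∀ k, t (k + 1) / σ (k + 1) ≤ t k / σ k)
    (htη : ∀ k, t k / t (k + 1) = η (k + 1))
    (hτ : ∀ k, 0 < τ k) (hη : 0 ≤ η K)
    (ha : ∀ k, 0 ≤ a k) (hb : ∀ k, 0 ≤ b k) (hJ0 : J 0 = 0)
    (hstep : ∀ k < K, gap k ≤ e k + J (k + 1) - η k * J k
      + 1 / τ k * (a k - a (k + 1)) + 1 / σ k * (b k - b (k + 1)))
    (hJK : J K ≤ ρ * b K) (hρ : η K * ρ ≤ 1 / σ K) :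
    ∑ k ∈ Finset.range K, t k * gap k
      ≤ ∑ k ∈ Finset.range K, t k * e k + a 0 / τ 0 + b 0 / σ 0 := by
  have hinv : ∀ n ≤ K, ∑ k ∈ Finset.range n, t k * gap k
      ≤ ∑ k ∈ Finset.range n, t k * e k + a 0 / τ 0 + b 0 / σ 0
        + t n * η n * J n - t n / τ n * a n - t n / σ n * b n := by
    intro n
    induction n with
    | zero =>
      intro _
      simp only [Finset.range_zero, Finset.sum_empty, hJ0, ht0]
      exact le_of_eq (by ring)
    | succ n ih =>
      intro hn
      have h1 := ih (by omega)
      have h2 := mul_le_mul_of_nonneg_left (hstep n hn) (ht n).le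
      have h3 := mul_le_mul_of_nonneg_right (htτ n) (ha (n + 1))
      have h4 := mul_le_mul_of_nonneg_right (htσ n) (hb (n + 1))
      have h5 : t (n + 1) * η (n + 1) = t n := by
        rw [← htη, mul_div_cancel₀ _ (ht (n + 1)).ne']
      rw [Finset.sum_range_succ, Finset.sum_range_succ, h5]
      have h6 : t n * (e n + J (n + 1) - η n * J n
          + 1 / τ n * (a n - a (n + 1)) + 1 / σ n * (b n - b (n + 1)))
          = t n * e n + t n * J (n + 1) - t n * η n * J n
            + (t n / τ n * a n - t n / τ n * a (n + 1))
            + (t n / σ n * b n - t n / σ n * b (n + 1)) := by ring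
      linarith
  have h1 := hinv K le_rfl
  have h2 : 0 ≤ t K / τ K * a K := mul_nonneg (div_nonneg (ht K).le (hτ K).le) (ha K)
  have h3 : t K * η K * J K ≤ t K / σ K * b K := by
    calc t K * η K * J K ≤ t K * η K * (ρ * b K) :=
          mul_le_mul_of_nonneg_left hJK (mul_nonneg (ht K).le hη)
      _ = t K * b K * (η K * ρ) := by ring
      _ ≤ t K * b K * (1 / σ K) :=
          mul_le_mul_of_nonneg_left hρ (mul_nonneg (ht K).le (hb K))
      _ = t K / σ K * b K := by ring
  linarith

lemma sum_range_one_div_succ_sq_le (K : ℕ) :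
    ∑ k ∈ Finset.range K, 1 / ((k : ℝ) + 1) ^ 2 ≤ Real.pi ^ 2 / 6 := by
  have h := sum_le_hasSum (Finset.range (K + 1)) (fun n _ => by positivity) hasSum_zeta_two
  rw [Finset.sum_range_succ'] at h
  simpa using h

lemma ConvexOn.map_weighted_average_le {E : Type*} [AddCommGroup E] [Module ℝ E] {C : Set E}
    {F : E → ℝ} (hF : ConvexOn ℝ C F) {K : ℕ} {t : ℕ → ℝ} {z : ℕ → E} {S : ℝ}
    (ht : ∀ k, 0 < t k) (hS : S = ∑ k ∈ Finset.range K, t k) (hS0 : 0 < S) (hz : ∀ k, z k ∈ C) :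
    F (S⁻¹ • ∑ k ∈ Finset.range K, t k • z k) ≤ S⁻¹ * ∑ k ∈ Finset.range K, t k * F (z k) := by
  have h := hF.map_sum_le (t := Finset.range K) (w := fun k => S⁻¹ * t k) (p := z)
    (fun k _ => mul_nonneg (inv_nonneg.2 hS0.le) (ht k).le)
    (by rw [← Finset.mul_sum, ← hS, inv_mul_cancel₀ hS0.ne']) (fun k _ => hz k)
  simpa [Finset.smul_sum, Finset.mul_sum, smul_smul, mul_assoc] using h

theorem stmt_10
    {X : Type*} [NormedAddCommGroup X] [InnerProductSpace ℝ X] [FiniteDimensional ℝ X]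
    {Y : Type*} [NormedAddCommGroup Y] [InnerProductSpace ℝ Y] [FiniteDimensional ℝ Y]
    {T : Type*} [NormedAddCommGroup T] [InnerProductSpace ℝ T] [FiniteDimensional ℝ T]
    (domf : Set X) (domh : Set Y) (Θset : Set T)
    (hdomf_ne : domf.Nonempty) (hdomh_ne : domh.Nonempty)
    (hdomf_conv : Convex ℝ domf) (hdomh_conv : Convex ℝ domh)
    (hΘ_conv : Convex ℝ Θset) (hΘ_ne : Θset.Nonempty)
    (B : ℝ) (hB : 0 < B) (ε : ℝ) (hε : 0 < ε) (ℓstar : ℝ)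
    (f : X → ℝ) (h : Y → ℝ)
    (hfconv : ConvexOn ℝ domf f) (hhconv : ConvexOn ℝ domh h)
    (hflsc : LowerSemicontinuousOn f domf) (hhlsc : LowerSemicontinuousOn h domh)
    (g1 : X → T → ℝ) (g2 : X → Y → ℝ) (ℓf : T → ℝ)
    (g1x : X → T → X) (g1θ : X → T → T)
    (g2x : X → Y → X) (g2y : X → Y → Y) (gℓ : T → T)
    (L1xx L1xθ L2xx L2xy L2yx L2yy L1θx L1θθ Lℓθ Lℓw : ℝ)
    (hL1xx : 0 ≤ L1xx) (hL1xθ : 0 ≤ L1xθ) (hL2xx : 0 ≤ L2xx) (hL2xy : 0 ≤ L2xy)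
    (hL2yx : 0 ≤ L2yx) (hL2yy : 0 ≤ L2yy) (hL1θx : 0 ≤ L1θx) (hL1θθ : 0 ≤ L1θθ)
    (hLℓθ : 0 ≤ Lℓθ) (hLℓw : 0 ≤ Lℓw)
    (hg1convx : ∀ θ ∈ Θset, ConvexOn ℝ domf (fun x => g1 x θ))
    (hg2convx : ∀ y ∈ domh, ConvexOn ℝ domf (fun x => g2 x y))
    (hg1x : ∀ x ∈ domf, ∀ θ ∈ Θset, HasGradientAt (fun x' => g1 x' θ) (g1x x θ) x)
    (hg1θ : ∀ x ∈ domf, ∀ θ ∈ Θset, HasGradientAt (fun θ' => g1 x θ') (g1θ x θ) θ)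
    (hg2x : ∀ x ∈ domf, ∀ y ∈ domh, HasGradientAt (fun x' => g2 x' y) (g2x x y) x)
    (hg2y : ∀ x ∈ domf, ∀ y ∈ domh, HasGradientAt (fun y' => g2 x y') (g2y x y) y)
    (hgℓ : ∀ θ ∈ Θset, HasGradientAt ℓf (gℓ θ) θ)
    (hLip1x : ∀ x ∈ domf, ∀ x' ∈ domf, ∀ θ ∈ Θset, ∀ θ' ∈ Θset,
      ‖g1x x θ - g1x x' θ'‖ ≤ L1xx * ‖x - x'‖ + L1xθ * ‖θ - θ'‖)
    (hLip2x : ∀ x ∈ domf, ∀ x' ∈ domf, ∀ y ∈ domh, ∀ y' ∈ domh,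
      ‖g2x x y - g2x x' y'‖ ≤ L2xx * ‖x - x'‖ + L2xy * ‖y - y'‖)
    (hLip2y : ∀ x ∈ domf, ∀ x' ∈ domf, ∀ y ∈ domh, ∀ y' ∈ domh,
      ‖g2y x y - g2y x' y'‖ ≤ L2yx * ‖x - x'‖ + L2yy * ‖y - y'‖)
    (hLip1θ : ∀ x ∈ domf, ∀ x' ∈ domf, ∀ θ ∈ Θset, ∀ θ' ∈ Θset,
      ‖g1θ x θ - g1θ x' θ'‖ ≤ L1θx * ‖x - x'‖ + L1θθ * ‖θ - θ'‖)
    (hLipℓ : ∀ θ ∈ Θset, ∀ θ' ∈ Θset, ∀ w ∈ Set.Icc (0 : ℝ) B, ∀ w' ∈ Set.Icc (0 : ℝ) B,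
      ‖w' • gℓ θ' - w • gℓ θ‖ ≤ Lℓθ * ‖θ - θ'‖ + Lℓw * |w - w'|)
    (hg1conc : ∀ x ∈ domf, ConcaveOn ℝ Θset (fun θ => g1 x θ))
    (hg2conc : ∀ x ∈ domf, ConcaveOn ℝ domh (fun y => g2 x y))
    (hℓconv : ConvexOn ℝ Θset ℓf)
    (φX : X → ℝ) (gφX : X → X) (UX : Set X) (hUXopen : IsOpen UX) (hUXf : domf ⊆ UX)
    (hφX : ∀ x ∈ UX, HasGradientAt φX (gφX x) x)
    (DX : X → X → ℝ)
    (hDXdef : ∀ x x', DX x x' = φX x - φX x' - ⟪gφX x', x - x'⟫)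
    (hDXlb : ∀ x, ∀ x' ∈ domf, 1 / 2 * ‖x - x'‖ ^ 2 ≤ DX x x')
    (φY : Y → ℝ) (gφY : Y → Y) (UY : Set Y) (hUYopen : IsOpen UY) (hUYh : domh ⊆ UY)
    (hφY : ∀ y ∈ UY, HasGradientAt φY (gφY y) y)
    (DY : Y → Y → ℝ)
    (hDYdef : ∀ y y', DY y y' = φY y - φY y' - ⟪gφY y', y - y'⟫)
    (hDYlb : ∀ y, ∀ y' ∈ domh, 1 / 2 * ‖y - y'‖ ^ 2 ≤ DY y y')
    (φT : T → ℝ) (gφT : T → T) (UT : Set T) (hUTopen : IsOpen UT) (hUTθ : Θset ⊆ UT)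
    (hφT : ∀ θ ∈ UT, HasGradientAt φT (gφT θ) θ)
    (DΘ : T → T → ℝ)
    (hDΘdef : ∀ θ θ', DΘ θ θ' = φT θ - φT θ' - ⟪gφT θ', θ - θ'⟫)
    (hDΘlb : ∀ θ, ∀ θ' ∈ Θset, 1 / 2 * ‖θ - θ'‖ ^ 2 ≤ DΘ θ θ')
    (φW : ℝ → ℝ) (dφW : ℝ → ℝ) (UW : Set ℝ) (hUWopen : IsOpen UW) (hUWw : Set.Icc (0 : ℝ) B ⊆ UW)
    (hφW : ∀ w ∈ UW, HasDerivAt φW (dφW w) w)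
    (DW : ℝ → ℝ → ℝ)
    (hDWdef : ∀ w w', DW w w' = φW w - φW w' - dφW w' * (w - w'))
    (hDWlb : ∀ w : ℝ, ∀ w' ∈ Set.Icc (0 : ℝ) B, 1 / 2 * |w - w'| ^ 2 ≤ DW w w')
    (τs σs ηs αs βs : ℕ → ℝ)
    (hτs : ∀ k, 0 < τs k) (hσs : ∀ k, 0 < σs k) (hηs : ∀ k, 0 ≤ ηs k)
    (hαs : ∀ k, 0 < αs k) (hβs : ∀ k, 0 < βs k)
    (xx : ℕ → X) (ww : ℕ → ℝ) (yy : ℕ → Y) (θθ : ℕ → T) (ℓk : ℕ → ℝ)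
    (hxx : ∀ k, xx k ∈ domf) (hww : ∀ k, ww k ∈ Set.Icc (0 : ℝ) B)
    (hyy : ∀ k, yy k ∈ domh) (hθθ : ∀ k, θθ k ∈ Θset)
    (hyupd : ∀ k : ℕ, ∀ y' ∈ domh,
      h (yy (k + 1))
        - ⟪(1 + ηs k) • g2y (xx k) (yy k) - ηs k • g2y (xx (k - 1)) (yy (k - 1)), yy (k + 1)⟫
        + 1 / σs k * DY (yy (k + 1)) (yy k)
      ≤ h y'
        - ⟪(1 + ηs k) • g2y (xx k) (yy k) - ηs k • g2y (xx (k - 1)) (yy (k - 1)), y'⟫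
        + 1 / σs k * DY y' (yy k))
    (hθupd : ∀ k : ℕ, ∀ θ' ∈ Θset,
      -⟪(1 + ηs k) • (g1θ (xx k) (θθ k) - ww k • gℓ (θθ k))
          - ηs k • (g1θ (xx (k - 1)) (θθ (k - 1)) - ww (k - 1) • gℓ (θθ (k - 1))), θθ (k + 1)⟫
        + 1 / σs k * DΘ (θθ (k + 1)) (θθ k)
      ≤ -⟪(1 + ηs k) • (g1θ (xx k) (θθ k) - ww k • gℓ (θθ k))
          - ηs k • (g1θ (xx (k - 1)) (θθ (k - 1)) - ww (k - 1) • gℓ (θθ (k - 1))), θ'⟫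
        + 1 / σs k * DΘ θ' (θθ k))
    (hxupd : ∀ k : ℕ, ∀ x' ∈ domf,
      f (xx (k + 1)) + ⟪g1x (xx k) (θθ (k + 1)) + g2x (xx k) (yy (k + 1)), xx (k + 1)⟫
        + 1 / τs k * DX (xx (k + 1)) (xx k)
      ≤ f x' + ⟪g1x (xx k) (θθ (k + 1)) + g2x (xx k) (yy (k + 1)), x'⟫
        + 1 / τs k * DX x' (xx k))
    (hwupd : ∀ k : ℕ, ∀ w' ∈ Set.Icc (0 : ℝ) B,
      -((ℓf (θθ (k + 1)) - ℓk (k + 1) - ε) * ww (k + 1)) + 1 / τs k * DW (ww (k + 1)) (ww k)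
      ≤ -((ℓf (θθ (k + 1)) - ℓk (k + 1) - ε) * w') + 1 / τs k * DW w' (ww k))
    (ts : ℕ → ℝ) (htpos : ∀ k, 0 < ts k) (ht0 : ts 0 = 1)
    (htτ : ∀ k : ℕ, ts (k + 1) / τs (k + 1) ≤ ts k / τs k)
    (htσ : ∀ k : ℕ, ts (k + 1) / σs (k + 1) ≤ ts k / σs k)
    (htη : ∀ k : ℕ, ts k / ts (k + 1) = ηs (k + 1))
    (hts1 : ∀ k : ℕ, ts k ≤ 1)
    (Rx Rw Ry Rθ : ℝ)
    (hRx : ∀ x ∈ domf, ∀ x' ∈ domf, DX x x' ≤ Rx)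
    (hRw : ∀ w ∈ Set.Icc (0 : ℝ) B, ∀ w' ∈ Set.Icc (0 : ℝ) B, DW w w' ≤ Rw)
    (hRy : ∀ y ∈ domh, ∀ y' ∈ domh, DY y y' ≤ Ry)
    (hRθ : ∀ θ ∈ Θset, ∀ θ' ∈ Θset, DΘ θ θ' ≤ Rθ)
    (c₀ c₁ : ℝ) (hc₀ : 0 < c₀) (hc₁ : 0 < c₁)
    (hBc : B ≤ c₀ / ε)
    (hℓrate : ∀ k : ℕ, |ℓk (k + 1) - ℓstar| ≤ c₁ / ((k : ℝ) + 1) ^ 2)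
    :
    ∀ K : ℕ, 1 ≤ K →
    (∀ k < K,
      (g1 (xx (k + 1)) (θθ (k + 1)) - g1 (xx k) (θθ (k + 1))
          - ⟪g1x (xx k) (θθ (k + 1)), xx (k + 1) - xx k⟫)
        + (g2 (xx (k + 1)) (yy (k + 1)) - g2 (xx k) (yy (k + 1))
            - ⟪g2x (xx k) (yy (k + 1)), xx (k + 1) - xx k⟫)
        + 1 / (2 * αs (k + 1)) * ‖g2y (xx (k + 1)) (yy (k + 1)) - g2y (xx k) (yy (k + 1))‖ ^ 2
        + 1 / βs (k + 1) * ‖g2y (xx k) (yy (k + 1)) - g2y (xx k) (yy k)‖ ^ 2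
        + 1 / αs (k + 1) * ‖g1θ (xx (k + 1)) (θθ (k + 1)) - g1θ (xx k) (θθ (k + 1))‖ ^ 2
        + 1 / αs (k + 1) * ‖g1θ (xx k) (θθ (k + 1)) - g1θ (xx k) (θθ k)‖ ^ 2
        + 1 / βs (k + 1) * ‖(ww k - ww (k + 1)) • gℓ (θθ (k + 1))‖ ^ 2
        + 1 / βs (k + 1) * ‖ww k • (gℓ (θθ k) - gℓ (θθ (k + 1)))‖ ^ 2
        - (1 / σs k - ηs k * (αs k + βs k)) * (DY (yy (k + 1)) (yy k) + DΘ (θθ (k + 1)) (θθ k))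
        - 1 / τs k * (DX (xx (k + 1)) (xx k) + DW (ww (k + 1)) (ww k)) ≤ 0) →
    1 / σs K ≥ ηs K * (αs K + βs K) →
    ∀ TK : ℝ, TK = ∑ k ∈ Finset.range K, ts k →
    ∀ xb : X, xb = TK⁻¹ • ∑ k ∈ Finset.range K, ts k • xx (k + 1) →
    ∀ wb : ℝ, wb = TK⁻¹ * ∑ k ∈ Finset.range K, ts k * ww (k + 1) →
    ∀ yb : Y, yb = TK⁻¹ • ∑ k ∈ Finset.range K, ts k • yy (k + 1) →
    ∀ θb : T, θb = TK⁻¹ • ∑ k ∈ Finset.range K, ts k • θθ (k + 1) →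
    (∀ x ∈ domf, ∀ w ∈ Set.Icc (0 : ℝ) B, ∀ y ∈ domh, ∀ θ ∈ Θset,
      (f xb + g1 xb θ + g2 xb y - wb * (ℓf θ - ℓstar - ε) - h y)
        - (f x + g1 x θb + g2 x yb - w * (ℓf θb - ℓstar - ε) - h yb)
      ≤ 1 / TK * (Rx / τs 0 + Rw / τs 0 + Ry / σs 0 + Rθ / σs 0)
        + c₀ * c₁ * Real.pi ^ 2 / (3 * TK * ε))
    ∧ (ε = 1 / Real.sqrt (K : ℝ) →
        c₀ * c₁ * Real.pi ^ 2 / (3 * TK * ε)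
          = c₀ * c₁ * Real.pi ^ 2 * Real.sqrt (K : ℝ) / (3 * TK)) := by
  intro K hK hE hKσ S hS xb hxb wb hwb yb hyb θb hθb
  have hS0 : 0 < S := by
    rw [hS]
    exact Finset.sum_pos (fun k _ => htpos k) (Finset.nonempty_range_iff.2 (by omega))
  refine ⟨fun x hx w hw y hy θ hθ => ?_, fun hεK => ?_⟩
  swap
  · have hsqrt : 0 < Real.sqrt (K : ℝ) := Real.sqrt_pos.2 (by exact_mod_cast hK)
    rw [hεK]
    field_simp
  set q : ℕ → T := fun k => g1θ (xx k) (θθ k) - ww k • gℓ (θθ k) with hq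
  set p : ℕ → Y := fun k => g2y (xx k) (yy k) with hp
  set Qp : ℕ → ℝ := fun k =>
    1 / (2 * αs k) * ‖g2y (xx k) (yy k) - g2y (xx (k - 1)) (yy k)‖ ^ 2
      + 1 / βs k * ‖g2y (xx (k - 1)) (yy k) - g2y (xx (k - 1)) (yy (k - 1))‖ ^ 2 with hQp
  set Qq : ℕ → ℝ := fun k =>
    1 / αs k * ‖g1θ (xx k) (θθ k) - g1θ (xx (k - 1)) (θθ k)‖ ^ 2
      + 1 / αs k * ‖g1θ (xx (k - 1)) (θθ k) - g1θ (xx (k - 1)) (θθ (k - 1))‖ ^ 2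
      + 1 / βs k * ‖(ww (k - 1) - ww k) • gℓ (θθ k)‖ ^ 2
      + 1 / βs k * ‖ww (k - 1) • (gℓ (θθ (k - 1)) - gℓ (θθ k))‖ ^ 2 with hQq
  have hyoungp : ∀ k (z : Y), -⟪p k - p (k - 1), z⟫ ≤ Qp k + (αs k + βs k) / 2 * ‖z‖ ^ 2 := by
    intro k z
    have h1 := neg_inner_le_young (g2y (xx k) (yy k) - g2y (xx (k - 1)) (yy k)) z (hαs k)
    have h2 := neg_inner_le_young
      (g2y (xx (k - 1)) (yy k) - g2y (xx (k - 1)) (yy (k - 1))) z (hβs k)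
    have h3 : 1 / (2 * βs k) ≤ 1 / βs k :=
      one_div_le_one_div_of_le (hβs k) (by linarith [hβs k])
    have h4 := mul_le_mul_of_nonneg_right h3
      (sq_nonneg ‖g2y (xx (k - 1)) (yy k) - g2y (xx (k - 1)) (yy (k - 1))‖)
    have hsplit : p k - p (k - 1) = (g2y (xx k) (yy k) - g2y (xx (k - 1)) (yy k))
        + (g2y (xx (k - 1)) (yy k) - g2y (xx (k - 1)) (yy (k - 1))) := by
      simp only [hp]
      abel
    rw [hsplit, inner_add_left]
    simp only [hQp]
    linarith
  have hyoungq : ∀ k (z : T), -⟪q k - q (k - 1), z⟫ ≤ Qq k + (αs k + βs k) / 2 * ‖z‖ ^ 2 := by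
    intro k z
    have h1 := neg_inner_add_le_young (g1θ (xx k) (θθ k) - g1θ (xx (k - 1)) (θθ k))
      (g1θ (xx (k - 1)) (θθ k) - g1θ (xx (k - 1)) (θθ (k - 1))) z (hαs k)
    have h2 := neg_inner_add_le_young ((ww (k - 1) - ww k) • gℓ (θθ k))
      (ww (k - 1) • (gℓ (θθ (k - 1)) - gℓ (θθ k))) z (hβs k)
    have hsplit : q k - q (k - 1) =
        ((g1θ (xx k) (θθ k) - g1θ (xx (k - 1)) (θθ k))
          + (g1θ (xx (k - 1)) (θθ k) - g1θ (xx (k - 1)) (θθ (k - 1))))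
        + ((ww (k - 1) - ww k) • gℓ (θθ k)
          + ww (k - 1) • (gℓ (θθ (k - 1)) - gℓ (θθ k))) := by
      simp only [hq]
      module
    rw [hsplit, inner_add_left]
    simp only [hQq]
    linarith
  set a : ℕ → ℝ := fun k => DX x (xx k) + DW w (ww k) with ha
  set b : ℕ → ℝ := fun k => DY y (yy k) + DΘ θ (θθ k) with hb
  set J : ℕ → ℝ := fun k =>
    ⟪p k - p (k - 1), y - yy k⟫ + ⟪q k - q (k - 1), θ - θθ k⟫ - Qp k - Qq k with hJ
  set gap : ℕ → ℝ := fun k =>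
    (f (xx (k + 1)) + g1 (xx (k + 1)) θ + g2 (xx (k + 1)) y
        - ww (k + 1) * (ℓf θ - ℓstar - ε) - h y)
      - (f x + g1 x (θθ (k + 1)) + g2 x (yy (k + 1))
        - w * (ℓf (θθ (k + 1)) - ℓstar - ε) - h (yy (k + 1))) with hgap
  have ha0 : ∀ k, 0 ≤ a k := fun k =>
    add_nonneg (le_trans (by positivity) (hDXlb x _ (hxx k)))
      (le_trans (by positivity) (hDWlb w _ (hww k)))
  have hb0 : ∀ k, 0 ≤ b k := fun k =>
    add_nonneg (le_trans (by positivity) (hDYlb y _ (hyy k)))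
      (le_trans (by positivity) (hDΘlb θ _ (hθθ k)))
  have hJ0 : J 0 = 0 := by simp [hJ, hQp, hQq]
  have hJK : J K ≤ (αs K + βs K) * b K := by
    have h1 := hyoungp K (-(y - yy K))
    have h2 := hyoungq K (-(θ - θθ K))
    rw [inner_neg_right, norm_neg] at h1 h2
    have h3 := mul_le_mul_of_nonneg_left (hDYlb y _ (hyy K)) (add_pos (hαs K) (hβs K)).le
    have h4 := mul_le_mul_of_nonneg_left (hDΘlb θ _ (hθθ K)) (add_pos (hαs K) (hβs K)).le
    simp only [hJ, hb]
    linarith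
  have hstep : ∀ k < K, gap k ≤ B * (c₁ / ((k : ℝ) + 1) ^ 2) + J (k + 1) - ηs k * J k
      + 1 / τs k * (a k - a (k + 1)) + 1 / σs k * (b k - b (k + 1)) := by
    intro k hk
    have hEk : (g1 (xx (k + 1)) (θθ (k + 1)) - g1 (xx k) (θθ (k + 1))
          - ⟪g1x (xx k) (θθ (k + 1)), xx (k + 1) - xx k⟫)
        + (g2 (xx (k + 1)) (yy (k + 1)) - g2 (xx k) (yy (k + 1))
            - ⟪g2x (xx k) (yy (k + 1)), xx (k + 1) - xx k⟫)
        + Qp (k + 1) + Qq (k + 1)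
        - (1 / σs k - ηs k * (αs k + βs k)) * (DY (yy (k + 1)) (yy k) + DΘ (θθ (k + 1)) (θθ k))
        - 1 / τs k * (DX (xx (k + 1)) (xx k) + DW (ww (k + 1)) (ww k)) ≤ 0 := by
      have hEk' := hE k hk
      simp only [hQp, hQq, Nat.add_sub_cancel]
      linarith
    -- proximal inequalities of the four blocks
    have hproxx := bregman_prox_three_point
      (F := fun z => f z + ⟪g1x (xx k) (θθ (k + 1)) + g2x (xx k) (yy (k + 1)), z⟫)
      (hfconv.add ((innerSL ℝ _).toLinearMap.convexOn hdomf_conv)) hDXdef (hxx (k + 1)) hx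
      (hφX _ (hUXf (hxx (k + 1)))) (hτs k) (hxupd k)
    have hproxw := bregman_prox_three_point (E := ℝ) (C := Set.Icc (0 : ℝ) B) (φ := φW)
      (gφ := dφW) (D := DW) (z := w) (z₀ := ww k) (z₁ := ww (k + 1))
      (F := fun z => -((ℓf (θθ (k + 1)) - ℓk (k + 1) - ε) * z))
      ((LinearMap.mulLeft ℝ (ℓf (θθ (k + 1)) - ℓk (k + 1) - ε)).concaveOn (convex_Icc 0 B)).neg
      (fun z z' => by rw [hDWdef, real_inner_comm]; simp) (hww (k + 1)) hw
      (hφW _ (hUWw (hww (k + 1)))).hasGradientAt' (hτs k) (hwupd k)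
    have hproxy := bregman_prox_three_point
      (F := fun z => h z - ⟪(1 + ηs k) • p k - ηs k • p (k - 1), z⟫)
      (hhconv.sub ((innerSL ℝ _).toLinearMap.concaveOn hdomh_conv)) hDYdef (hyy (k + 1)) hy
      (hφY _ (hUYh (hyy (k + 1)))) (hσs k) (hyupd k)
    have hproxθ := bregman_prox_three_point
      (F := fun z => -⟪(1 + ηs k) • q k - ηs k • q (k - 1), z⟫)
      ((innerSL ℝ _).toLinearMap.concaveOn hΘ_conv).neg hDΘdef (hθθ (k + 1)) hθ
      (hφT _ (hUTθ (hθθ (k + 1)))) (hσs k) (hθupd k)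
    -- first-order inequalities of the couplings
    have hcx1 := (hg1convx _ (hθθ (k + 1))).add_inner_gradient_le
      (hg1x _ (hxx k) _ (hθθ (k + 1))) (hxx k) hx
    have hcx2 := (hg2convx _ (hyy (k + 1))).add_inner_gradient_le
      (hg2x _ (hxx k) _ (hyy (k + 1))) (hxx k) hx
    have hcθ := (hg1conc _ (hxx (k + 1))).le_add_inner_gradient
      (hg1θ _ (hxx (k + 1)) _ (hθθ (k + 1))) (hθθ (k + 1)) hθ
    have hcy := (hg2conc _ (hxx (k + 1))).le_add_inner_gradient
      (hg2y _ (hxx (k + 1)) _ (hyy (k + 1))) (hyy (k + 1)) hy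
    have hcℓ := mul_le_mul_of_nonneg_left
      (hℓconv.add_inner_gradient_le (hgℓ _ (hθθ (k + 1))) (hθθ (k + 1)) hθ) (hww (k + 1)).1
    -- momentum errors
    have hyp := mul_le_mul_of_nonneg_left (hyoungp k (yy k - yy (k + 1))) (hηs k)
    have hyq := mul_le_mul_of_nonneg_left (hyoungq k (θθ k - θθ (k + 1))) (hηs k)
    have hηαβ : 0 ≤ ηs k * (αs k + βs k) := mul_nonneg (hηs k) (add_pos (hαs k) (hβs k)).le
    have hDyk := mul_le_mul_of_nonneg_left (hDYlb (yy (k + 1)) _ (hyy k)) hηαβ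
    have hDθk := mul_le_mul_of_nonneg_left (hDΘlb (θθ (k + 1)) _ (hθθ k)) hηαβ
    rw [norm_sub_rev] at hDyk hDθk
    have herr : (w - ww (k + 1)) * (ℓk (k + 1) - ℓstar) ≤ B * (c₁ / ((k : ℝ) + 1) ^ 2) := by
      refine (le_abs_self _).trans ?_
      rw [abs_mul]
      refine mul_le_mul ?_ (hℓrate k) (abs_nonneg _) hB.le
      have h1 := hww (k + 1)
      rw [abs_le]
      constructor <;> linarith [h1.1, h1.2, hw.1, hw.2]
    have hqinner : ⟪q (k + 1), θ - θθ (k + 1)⟫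
        = ⟪g1θ (xx (k + 1)) (θθ (k + 1)), θ - θθ (k + 1)⟫
          - ww (k + 1) * ⟪gℓ (θθ (k + 1)), θ - θθ (k + 1)⟫ := by
      simp only [hq, inner_sub_left, real_inner_smul_left]
    change g2 (xx (k + 1)) y ≤ g2 (xx (k + 1)) (yy (k + 1)) + ⟪p (k + 1), y - yy (k + 1)⟫ at hcy
    simp only [hgap, hJ, ha, hb, Nat.add_sub_cancel]
    simp only [inner_sub_right, inner_sub_left, inner_add_left, real_inner_smul_left]
      at hEk hproxx hproxy hproxθ hcx1 hcx2 hcθ hcy hcℓ hyp hyq hqinner ⊢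
    linarith
  have hmain := weighted_sum_le_of_step htpos ht0 htτ htσ htη hτs (hηs K) ha0 hb0 hJ0 hstep hJK hKσ
  have herr : ∑ k ∈ Finset.range K, ts k * (B * (c₁ / ((k : ℝ) + 1) ^ 2))
      ≤ c₀ * c₁ * Real.pi ^ 2 / (3 * ε) := by
    calc ∑ k ∈ Finset.range K, ts k * (B * (c₁ / ((k : ℝ) + 1) ^ 2))
        ≤ ∑ k ∈ Finset.range K, B * c₁ * (1 / ((k : ℝ) + 1) ^ 2) := by
          refine Finset.sum_le_sum fun k _ => ?_
          refine (mul_le_of_le_one_left (by positivity) (hts1 k)).trans (le_of_eq (by ring))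
      _ = B * c₁ * ∑ k ∈ Finset.range K, 1 / ((k : ℝ) + 1) ^ 2 := by rw [Finset.mul_sum]
      _ ≤ c₀ / ε * c₁ * (Real.pi ^ 2 / 3) := by
          have h1 := sum_range_one_div_succ_sq_le K
          have h2 := sq_nonneg Real.pi
          gcongr
          linarith
      _ = c₀ * c₁ * Real.pi ^ 2 / (3 * ε) := by field_simp
  have hainit : a 0 / τs 0 ≤ Rx / τs 0 + Rw / τs 0 := by
    rw [← add_div]
    exact div_le_div_of_nonneg_right (add_le_add (hRx x hx _ (hxx 0)) (hRw w hw _ (hww 0)))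
      (hτs 0).le
  have hbinit : b 0 / σs 0 ≤ Ry / σs 0 + Rθ / σs 0 := by
    rw [← add_div]
    exact div_le_div_of_nonneg_right (add_le_add (hRy y hy _ (hyy 0)) (hRθ θ hθ _ (hθθ 0)))
      (hσs 0).le
  have hjx := (((hfconv.add (hg1convx θ hθ)).add (hg2convx y hy))).map_weighted_average_le
    htpos hS hS0 (fun k => hxx (k + 1))
  have hjy := (hhconv.sub (hg2conc x hx)).map_weighted_average_le htpos hS hS0
    (fun k => hyy (k + 1))
  have hjθ := ((hℓconv.smul hw.1).sub (hg1conc x hx)).map_weighted_average_le htpos hS hS0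
    (fun k => hθθ (k + 1))
  rw [← hxb] at hjx
  rw [← hyb] at hjy
  rw [← hθb] at hjθ
  simp only [Pi.add_apply, Pi.sub_apply, smul_eq_mul] at hjx hjy hjθ
  have hsum : ∑ k ∈ Finset.range K, ts k * gap k
      = ∑ k ∈ Finset.range K, ts k * (f (xx (k + 1)) + g1 (xx (k + 1)) θ + g2 (xx (k + 1)) y)
        + ∑ k ∈ Finset.range K, ts k * (h (yy (k + 1)) - g2 x (yy (k + 1)))
        + ∑ k ∈ Finset.range K, ts k * (w * ℓf (θθ (k + 1)) - g1 x (θθ (k + 1)))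
        - (∑ k ∈ Finset.range K, ts k * ww (k + 1)) * (ℓf θ - ℓstar - ε)
        - S * (h y + f x + w * (ℓstar + ε)) := by
    rw [hS, Finset.sum_mul, Finset.sum_mul, ← Finset.sum_add_distrib, ← Finset.sum_add_distrib,
      ← Finset.sum_sub_distrib, ← Finset.sum_sub_distrib]
    refine Finset.sum_congr rfl fun k _ => ?_
    simp only [hgap]
    ring
  have hjensen : (f xb + g1 xb θ + g2 xb y - wb * (ℓf θ - ℓstar - ε) - h y)
        - (f x + g1 x θb + g2 x yb - w * (ℓf θb - ℓstar - ε) - h yb)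
      ≤ S⁻¹ * ∑ k ∈ Finset.range K, ts k * gap k := by
    have hSS : S⁻¹ * (S * (h y + f x + w * (ℓstar + ε))) = h y + f x + w * (ℓstar + ε) :=
      inv_mul_cancel_left₀ hS0.ne' _
    rw [hsum, mul_sub S⁻¹ _ (S * _), hSS, mul_sub S⁻¹ _ (_ * (ℓf θ - ℓstar - ε)),
      ← mul_assoc S⁻¹ _ (ℓf θ - ℓstar - ε), ← hwb]
    linarith
  calc _ ≤ S⁻¹ * ∑ k ∈ Finset.range K, ts k * gap k := hjensen
    _ ≤ S⁻¹ * ((Rx / τs 0 + Rw / τs 0 + Ry / σs 0 + Rθ / σs 0)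
          + c₀ * c₁ * Real.pi ^ 2 / (3 * ε)) :=
        mul_le_mul_of_nonneg_left (by linarith) (inv_nonneg.2 hS0.le)
    _ = _ := by field_simp
end

section
/- Let X, Y, T be nonempty sets, W ⊆ ℝ, ℓ: T → ℝ, ℓ* ∈ ℝ, ε ≥ 0, and let F: X × Y × T → ℝ. Define L(x, w, y, θ) = F(x, y, θ) − w·(ℓ(θ) − ℓ* − ε) for x ∈ X, w ∈ ℝ, y ∈ Y, θ ∈ T. Suppose (x*, w*, y*, θ*) with x* ∈ X, w* ∈ W, y* ∈ Y, θ* ∈ T is a saddle point, i.e., L(x*, w*, y, θ) ≤ L(x*, w*, y*, θ*) ≤ L(x, w, y*, θ*) for all x ∈ X, w ∈ W, y ∈ Y, θ ∈ T. Then for every (x̂, ŵ, ŷ, θ̂) ∈ X × W × Y × T: L(x̂, ŵ, y*, θ*) − L(x*, w* + 1, ŷ, θ̂) ≥ ℓ(θ̂) − ℓ* − ε, where L(x*, w* + 1, ŷ, θ̂) is evaluated by the defining formula. -/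
open RealInnerProductSpace

theorem stmt_12
    {X Y T : Type*} [Nonempty X] [Nonempty Y] [Nonempty T]
    (W : Set ℝ) (ℓ : T → ℝ) (ℓstar ε : ℝ) (hε : 0 ≤ ε)
    (F : X → Y → T → ℝ)
    (L : X → ℝ → Y → T → ℝ)
    (hL : ∀ x w y θ, L x w y θ = F x y θ - w * (ℓ θ - ℓstar - ε))
    (xstar : X) (wstar : ℝ) (ystar : Y) (θstar : T)
    (hwstar : wstar ∈ W)
    (hsaddle : ∀ (x : X), ∀ w ∈ W, ∀ (y : Y) (θ : T),
      L xstar wstar y θ ≤ L xstar wstar ystar θstar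
      ∧ L xstar wstar ystar θstar ≤ L x w ystar θstar) :
    ∀ (xhat : X), ∀ what ∈ W, ∀ (yhat : Y) (θhat : T),
      L xhat what ystar θstar - L xstar (wstar + 1) yhat θhat ≥ ℓ θhat - ℓstar - ε := by
  intro xhat what hwhat yhat θhat
  have h := hsaddle xhat what hwhat yhat θhat
  have hshift : L xstar (wstar + 1) yhat θhat
      = L xstar wstar yhat θhat - (ℓ θhat - ℓstar - ε) := by
    rw [hL, hL]
    ring
  linarith [h.1, h.2]
end

section
/- Suppose Assumption A holds. Fix τ, σ > 0, η ≥ 0, points x_{k−1}, x_k ∈ dom f, y_{k−1}, y_k ∈ dom h, and θ_{k−1}, θ_k, θ_{k+1} ∈ Θ. Set q_k = ∇_yΦ(x_k, y_k; θ_k) − ∇_yΦ(x_{k−1}, y_{k−1}; θ_{k−1}) and s_k = ∇_yΦ(x_k, y_k; θ_k) + η·q_k. Let y_{k+1} be a minimizer over Y of y ↦ h(y) − ⟨s_k, y⟩ + (1/σ)·D_Y(y, y_k), and let x_{k+1} be a minimizer over X of x ↦ f(x) + ⟨∇_xΦ(x_k, y_{k+1}; θ_{k+1}), x⟩ + (1/τ)·D_X(x,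 x_k). Define q_{k+1} = ∇_yΦ(x_{k+1}, y_{k+1}; θ_{k+1}) − ∇_yΦ(x_k, y_k; θ_k) and Λ_k = Φ(x_{k+1}, y_{k+1}; θ_{k+1}) − Φ(x_k, y_{k+1}; θ_{k+1}) − ⟨∇_xΦ(x_k, y_{k+1}; θ_{k+1}), x_{k+1} − x_k⟩. Then for all x ∈ X and y ∈ Y: L(x_{k+1}, y; θ_{k+1}) − L(x, y_{k+1}; θ_{k+1}) ≤ −⟨q_{k+1}, y_{k+1} − y⟩ + η·⟨q_k, y_{k+1} − y⟩ + Λ_k + (1/σ)·[D_Y(y, y_k) − D_Y(y, y_{k+1}) − D_Y(y_{k+1}, y_k)] + (1/τ)·[D_X(x, x_k) − D_X(x, x_{k+1}) − D_X(x_{k+1}, x_k)]. -/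
open RealInnerProductSpace

section FirstOrder

variable {E : Type*} [NormedAddCommGroup E] [InnerProductSpace ℝ E] [CompleteSpace E]

/-- First-order optimality condition for the sum of a convex function and a differentiable one. -/
theorem ConvexOn.le_add_inner_of_isMinOn_add {s : Set E} {g ψ : E → ℝ} {z v : E}
    (hg : ConvexOn ℝ s g) (hψ : HasGradientAt ψ v z) (hz : z ∈ s)
    (hmin : IsMinOn (fun u => g u + ψ u) s z) {x : E} (hx : x ∈ s) :
    g z ≤ g x + ⟪v, x - z⟫ := by
  have hline : HasDerivAt (fun t : ℝ => ψ (z + t • (x - z))) ⟪v, x - z⟫ 0 := by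
    have hγ : HasDerivAt (fun t : ℝ => z + t • (x - z)) (x - z) 0 := by
      simpa using ((hasDerivAt_id (0 : ℝ)).smul_const (x - z)).const_add z
    have hψ' : HasFDerivAt ψ (InnerProductSpace.toDual ℝ E v) (z + (0 : ℝ) • (x - z)) := by
      simpa using hψ.hasFDerivAt
    exact hψ'.comp_hasDerivAt (0 : ℝ) hγ
  have hslope := hline.tendsto_slope_zero_right
  have hbound : g z - g x ≤ ⟪v, x - z⟫ := by
    refine ge_of_tendsto hslope ?_
    filter_upwards [Ioc_mem_nhdsGT (zero_lt_one' ℝ)] with t ht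
    have hcomb : z + t • (x - z) = (1 - t) • z + t • x := by module
    have hmem : z + t • (x - z) ∈ s := hcomb ▸
      hg.1 hz hx (sub_nonneg.2 ht.2) ht.1.le (sub_add_cancel 1 t)
    have hconv : g (z + t • (x - z)) ≤ (1 - t) * g z + t * g x := by
      rw [hcomb]
      exact hg.2 hz hx (sub_nonneg.2 ht.2) ht.1.le (sub_add_cancel 1 t)
    have hle : g z + ψ z ≤ g (z + t • (x - z)) + ψ (z + t • (x - z)) := hmin hmem
    simp only [zero_add, zero_smul, add_zero, smul_eq_mul]
    rw [inv_mul_eq_div, le_div_iff₀ ht.1]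
    linarith
  linarith

/-- The gradient inequality for a convex function. -/
theorem ConvexOn.add_inner_gradient_le_s14 {s : Set E} {g : E → ℝ} {z v : E}
    (hg : ConvexOn ℝ s g) (hgrad : HasGradientAt g v z) (hz : z ∈ s) {x : E} (hx : x ∈ s) :
    g z + ⟪v, x - z⟫ ≤ g x := by
  have hneg : HasGradientAt (fun u => -g u) (-v) z := by
    rw [hasGradientAt_iff_hasFDerivAt, map_neg]
    exact hgrad.hasFDerivAt.neg
  have := hg.le_add_inner_of_isMinOn_add hneg hz (by simp [isMinOn_iff]) hx
  rw [inner_neg_left] at this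
  linarith

/-- The gradient inequality for a concave function. -/
theorem ConcaveOn.le_add_inner_gradient_s14 {s : Set E} {g : E → ℝ} {z v : E}
    (hg : ConcaveOn ℝ s g) (hgrad : HasGradientAt g v z) (hz : z ∈ s) {x : E} (hx : x ∈ s) :
    g x ≤ g z + ⟪v, x - z⟫ := by
  have hneg : HasGradientAt (-g) (-v) z := by
    rw [hasGradientAt_iff_hasFDerivAt, map_neg]
    exact hgrad.hasFDerivAt.neg
  have := hg.neg.add_inner_gradient_le_s14 hneg hz hx
  simp only [inner_neg_left, Pi.neg_apply] at this
  linarith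

/-- The three-point inequality for a Bregman proximal step. -/
theorem ConvexOn.bregman_prox_three_point {s : Set E} {g φ : E → ℝ} {gφ : E → E}
    {D : E → E → ℝ} {a z w : E} {c : ℝ} (hg : ConvexOn ℝ s g)
    (hφ : HasGradientAt φ (gφ z) z)
    (hD : ∀ u u', D u u' = φ u - φ u' - ⟪gφ u', u - u'⟫) (hz : z ∈ s)
    (hmin : ∀ u ∈ s, g z + ⟪a, z⟫ + c * D z w ≤ g u + ⟪a, u⟫ + c * D u w)
    {x : E} (hx : x ∈ s) :
    g z - g x + ⟪a, z - x⟫ ≤ c * (D x w - D x z - D z w) := by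
  have hψ : HasGradientAt (fun u => ⟪a, u⟫ + c * D u w) (a + c • (gφ z - gφ w)) z := by
    rw [hasGradientAt_iff_hasFDerivAt, map_add, map_smul, map_sub]
    simp only [hD, inner_sub_right]
    have hinner (b : E) : HasFDerivAt (fun u => ⟪b, u⟫) (InnerProductSpace.toDual ℝ E b) z :=
      (InnerProductSpace.toDual ℝ E b).hasFDerivAt
    exact (hinner a).add
      (((hφ.hasFDerivAt.sub_const (φ w)).sub ((hinner (gφ w)).sub_const _)).const_mul c)
  have := hg.le_add_inner_of_isMinOn_add hψ hz
    (isMinOn_iff.2 fun u hu => by linarith [hmin u hu]) hx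
  simp only [hD, inner_add_left, inner_sub_left, inner_sub_right, real_inner_smul_left] at this ⊢
  linarith

end FirstOrder

theorem stmt_14
    {X : Type*} [NormedAddCommGroup X] [InnerProductSpace ℝ X] [FiniteDimensional ℝ X]
    {Y : Type*} [NormedAddCommGroup Y] [InnerProductSpace ℝ Y] [FiniteDimensional ℝ Y]
    {T : Type*} [NormedAddCommGroup T] [InnerProductSpace ℝ T] [FiniteDimensional ℝ T]
    (domf : Set X) (domh : Set Y) (Θset : Set T)
    (hdomf_ne : domf.Nonempty) (hdomh_ne : domh.Nonempty)
    (hdomf_conv : Convex ℝ domf) (hdomh_conv : Convex ℝ domh)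
    (f : X → ℝ) (h : Y → ℝ)
    (hfconv : ConvexOn ℝ domf f) (hhconv : ConvexOn ℝ domh h)
    (hflsc : LowerSemicontinuousOn f domf) (hhlsc : LowerSemicontinuousOn h domh)
    (Φ : X → Y → T → ℝ) (gradxΦ : X → Y → T → X) (gradyΦ : X → Y → T → Y)
    (Lxx Lxθ Lyx Lyy Lyθ : ℝ)
    (hLxx : 0 ≤ Lxx) (hLxθ : 0 ≤ Lxθ) (hLyx : 0 ≤ Lyx) (hLyy : 0 ≤ Lyy) (hLyθ : 0 ≤ Lyθ)
    (hΦconvx : ∀ y ∈ domh, ∀ θ ∈ Θset, ConvexOn ℝ domf (fun x => Φ x y θ))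
    (hΦconcy : ∀ x ∈ domf, ∀ θ ∈ Θset, ConcaveOn ℝ domh (fun y => Φ x y θ))
    (hgradx : ∀ x ∈ domf, ∀ y ∈ domh, ∀ θ ∈ Θset,
      HasGradientAt (fun x' => Φ x' y θ) (gradxΦ x y θ) x)
    (hgrady : ∀ x ∈ domf, ∀ y ∈ domh, ∀ θ ∈ Θset,
      HasGradientAt (fun y' => Φ x y' θ) (gradyΦ x y θ) y)
    (hLipx : ∀ x ∈ domf, ∀ x' ∈ domf, ∀ y ∈ domh, ∀ θ ∈ Θset, ∀ θ' ∈ Θset,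
      ‖gradxΦ x y θ - gradxΦ x' y θ'‖ ≤ Lxx * ‖x - x'‖ + Lxθ * ‖θ - θ'‖)
    (hLipy : ∀ x ∈ domf, ∀ x' ∈ domf, ∀ y ∈ domh, ∀ y' ∈ domh, ∀ θ ∈ Θset, ∀ θ' ∈ Θset,
      ‖gradyΦ x y θ - gradyΦ x' y' θ'‖ ≤ Lyx * ‖x - x'‖ + Lyy * ‖y - y'‖ + Lyθ * ‖θ - θ'‖)
    (φX : X → ℝ) (gφX : X → X) (UX : Set X) (hUXopen : IsOpen UX) (hUXf : domf ⊆ UX)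
    (hφX : ∀ x ∈ UX, HasGradientAt φX (gφX x) x)
    (DX : X → X → ℝ)
    (hDXdef : ∀ x x', DX x x' = φX x - φX x' - ⟪gφX x', x - x'⟫)
    (hDXlb : ∀ x, ∀ x' ∈ domf, 1 / 2 * ‖x - x'‖ ^ 2 ≤ DX x x')
    (φY : Y → ℝ) (gφY : Y → Y) (UY : Set Y) (hUYopen : IsOpen UY) (hUYh : domh ⊆ UY)
    (hφY : ∀ y ∈ UY, HasGradientAt φY (gφY y) y)
    (DY : Y → Y → ℝ)
    (hDYdef : ∀ y y', DY y y' = φY y - φY y' - ⟪gφY y', y - y'⟫)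
    (hDYlb : ∀ y, ∀ y' ∈ domh, 1 / 2 * ‖y - y'‖ ^ 2 ≤ DY y y')
    (τ σ η : ℝ) (hτ : 0 < τ) (hσ : 0 < σ) (hη : 0 ≤ η)
    (xkm xk : X) (hxkm : xkm ∈ domf) (hxk : xk ∈ domf)
    (ykm yk : Y) (hykm : ykm ∈ domh) (hyk : yk ∈ domh)
    (θkm θk θkp : T) (hθkm : θkm ∈ Θset) (hθk : θk ∈ Θset) (hθkp : θkp ∈ Θset)
    (ykp : Y) (hykp : ykp ∈ domh)
    (hymin : ∀ y ∈ domh,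
      h ykp
        - ⟪gradyΦ xk yk θk + η • (gradyΦ xk yk θk - gradyΦ xkm ykm θkm), ykp⟫
        + 1 / σ * DY ykp yk
      ≤ h y
        - ⟪gradyΦ xk yk θk + η • (gradyΦ xk yk θk - gradyΦ xkm ykm θkm), y⟫
        + 1 / σ * DY y yk)
    (xkp : X) (hxkp : xkp ∈ domf)
    (hxmin : ∀ x ∈ domf,
      f xkp + ⟪gradxΦ xk ykp θkp, xkp⟫ + 1 / τ * DX xkp xk
      ≤ f x + ⟪gradxΦ xk ykp θkp, x⟫ + 1 / τ * DX x xk) :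
    ∀ x ∈ domf, ∀ y ∈ domh,
      (f xkp + Φ xkp y θkp - h y) - (f x + Φ x ykp θkp - h ykp)
      ≤ -⟪gradyΦ xkp ykp θkp - gradyΦ xk yk θk, ykp - y⟫
        + η * ⟪gradyΦ xk yk θk - gradyΦ xkm ykm θkm, ykp - y⟫
        + (Φ xkp ykp θkp - Φ xk ykp θkp - ⟪gradxΦ xk ykp θkp, xkp - xk⟫)
        + 1 / σ * (DY y yk - DY y ykp - DY ykp yk)
        + 1 / τ * (DX x xk - DX x xkp - DX xkp xk) := by
  intro x hx y hy
  have hxstep := hfconv.bregman_prox_three_point (hφX xkp (hUXf hxkp)) hDXdef hxkp hxmin hx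
  have hystep := hhconv.bregman_prox_three_point
    (a := -(gradyΦ xk yk θk + η • (gradyΦ xk yk θk - gradyΦ xkm ykm θkm)))
    (hφY ykp (hUYh hykp)) hDYdef hykp
    (fun u hu => by simpa only [inner_neg_left, ← sub_eq_add_neg] using hymin u hu) hy
  have hΦx := (hΦconvx ykp hykp θkp hθkp).add_inner_gradient_le_s14
    (hgradx xk hxk ykp hykp θkp hθkp) hxk hx
  have hΦy := (hΦconcy xkp hxkp θkp hθkp).le_add_inner_gradient_s14
    (hgrady xkp hxkp ykp hykp θkp hθkp) hykp hy
  simp only [inner_neg_left, inner_add_left, inner_sub_left, inner_sub_right,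
    real_inner_smul_left] at hxstep hystep hΦx hΦy ⊢
  linarith
end

section
/- Suppose Assumption A holds. Fix τ, σ > 0, η ≥ 0, points x_{k−1}, x_k ∈ dom f, y_{k−1}, y_k ∈ dom h, and θ_k, θ* ∈ Θ. Set s_k = (1+η)∇_yΦ(x_k, y_k; θ_k) − η∇_yΦ(x_{k−1}, y_{k−1}; θ_k). Let y_{k+1} be a minimizer over Y of y ↦ h(y) − ⟨s_k, y⟩ + (1/σ)·D_Y(y, y_k), and let x_{k+1} be a minimizer over X of x ↦ f(x) + ⟨∇_xΦ(x_k, y_{k+1}; θ_k), x⟩ + (1/τ)·D_X(x, x_k). Define q*_k = ∇_yΦ(x_k, y_k; θ*) − ∇_yΦ(x_{k−1}, y_{k−1}; θ*), q*_{k+1} = ∇_yΦ(x_{k+1}, y_{k+1}; θ*) − ∇_yΦ(x_k, y_k; θ*), and Λ*_k = Φ(x_{k+1}, y_{k+1}; θ*) − Φ(x_k, y_{k+1}; θ*) − ⟨∇_xΦ(x_k, y_{k+1}; θ*), x_{k+1} − x_k⟩. Then for all x ∈ X and y ∈ Y: L(x_{k+1}, y; θ*) − L(x, y_{k+1}; θ*)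 ≤ −⟨q*_{k+1}, y_{k+1} − y⟩ + η·⟨q*_k, y_{k+1} − y⟩ + (2η + 1)·L_yθ·‖θ_k − θ*‖·‖y_{k+1} − y‖ + L_xθ·‖θ_k − θ*‖·‖x_{k+1} − x‖ + Λ*_k + (1/σ)·[D_Y(y, y_k) − D_Y(y, y_{k+1}) − D_Y(y_{k+1}, y_k)] + (1/τ)·[D_X(x, x_k) − D_X(x, x_{k+1}) − D_X(x_{k+1}, x_k)]. -/
open RealInnerProductSpace

lemma ConvexOn.apply_add_smul_sub_le {E : Type*} [AddCommGroup E] [Module ℝ E]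
    {S : Set E} {g : E → ℝ} (hg : ConvexOn ℝ S g)
    {u z : E} (hu : u ∈ S) (hz : z ∈ S) {t : ℝ} (ht₀ : 0 ≤ t) (ht₁ : t ≤ 1) :
    g (u + t • (z - u)) ≤ g u + t * (g z - g u) := by
  have hconv := hg.2 hu hz (sub_nonneg.2 ht₁) ht₀ (by ring)
  have hpoint : u + t • (z - u) = (1 - t) • u + t • z := by module
  rw [hpoint]
  simp only [smul_eq_mul] at hconv
  linarith

section GradientInequalities

variable {E : Type*} [NormedAddCommGroup E] [InnerProductSpace ℝ E] [CompleteSpace E]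

lemma HasGradientAt.le_inner_of_forall_mul_le {ψ : E → ℝ} {G u d : E} {a : ℝ}
    (hψ : HasGradientAt ψ G u)
    (ha : ∀ t : ℝ, 0 < t → t ≤ 1 → t * a ≤ ψ (u + t • d) - ψ u) :
    a ≤ ⟪G, d⟫ := by
  have hline : HasDerivAt (fun t : ℝ => ψ (u + t • d)) ⟪G, d⟫ 0 := by
    simpa [HasLineDerivAt] using hψ.hasFDerivAt.hasLineDerivAt d
  have hlim := hline.tendsto_slope_zero_right
  refine ge_of_tendsto hlim ?_
  filter_upwards [Ioc_mem_nhdsGT (zero_lt_one' ℝ)] with t ht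
  have := ha t ht.1 ht.2
  simp only [zero_add, zero_smul, add_zero, smul_eq_mul]
  rw [inv_mul_eq_div, le_div_iff₀ ht.1]
  linarith

lemma ConcaveOn.le_add_inner_of_hasGradientAt {S : Set E} {g : E → ℝ} (hg : ConcaveOn ℝ S g)
    {u z G : E} (hu : u ∈ S) (hz : z ∈ S) (hG : HasGradientAt g G u) :
    g z ≤ g u + ⟪G, z - u⟫ := by
  have := hG.le_inner_of_forall_mul_le (d := z - u) (a := g z - g u) fun t ht₀ ht₁ => by
    have := hg.neg.apply_add_smul_sub_le hu hz ht₀.le ht₁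
    simp only [Pi.neg_apply] at this
    linarith
  linarith

lemma ConvexOn.add_inner_le_of_hasGradientAt {S : Set E} {g : E → ℝ} (hg : ConvexOn ℝ S g)
    {u z G : E} (hu : u ∈ S) (hz : z ∈ S) (hG : HasGradientAt g G u) :
    g u + ⟪G, z - u⟫ ≤ g z := by
  have hG' : HasGradientAt (-g) (-G) u := by
    rw [hasGradientAt_iff_hasFDerivAt, map_neg]
    exact hG.hasFDerivAt.neg
  have := hg.neg.le_add_inner_of_hasGradientAt hu hz hG'
  simp only [Pi.neg_apply, inner_neg_left] at this
  linarith

/-- First-order optimality for the sum of a convex function and a differentiable one. -/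
lemma ConvexOn.le_add_inner_of_forall_add_le {S : Set E} {g ψ : E → ℝ} (hg : ConvexOn ℝ S g)
    {u z G : E} (hu : u ∈ S) (hz : z ∈ S) (hG : HasGradientAt ψ G u)
    (hmin : ∀ w ∈ S, g u + ψ u ≤ g w + ψ w) :
    g u ≤ g z + ⟪G, z - u⟫ := by
  have := hG.le_inner_of_forall_mul_le (d := z - u) (a := g u - g z) fun t ht₀ ht₁ => by
    have hmin_t := hmin _ (hg.1.add_smul_sub_mem hu hz ⟨ht₀.le, ht₁⟩)
    have := hg.apply_add_smul_sub_le hu hz ht₀.le ht₁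
    linarith
  linarith

/-- The three-point inequality for a Bregman proximal step. -/
lemma ConvexOn.bregman_prox_le {S : Set E} {g : E → ℝ} (hg : ConvexOn ℝ S g)
    {φ : E → ℝ} {gφ : E → E} {D : E → E → ℝ}
    (hD : ∀ x x', D x x' = φ x - φ x' - ⟪gφ x', x - x'⟫)
    {u u₀ s z : E} {c : ℝ} (hu : u ∈ S) (hz : z ∈ S) (hφ : HasGradientAt φ (gφ u) u)
    (hmin : ∀ w ∈ S, g u + ⟪s, u⟫ + c * D u u₀ ≤ g w + ⟪s, w⟫ + c * D w u₀) :
    g u + ⟪s, u - z⟫ ≤ g z + c * (D z u₀ - D z u - D u u₀) := by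
  have hG : HasGradientAt (fun w => ⟪s, w⟫ + c * (φ w - ⟪gφ u₀, w⟫))
      (s + c • (gφ u - gφ u₀)) u := by
    rw [hasGradientAt_iff_hasFDerivAt, map_add, map_smul, map_sub]
    exact (InnerProductSpace.toDual ℝ E s).hasFDerivAt.add
      ((hφ.hasFDerivAt.sub (InnerProductSpace.toDual ℝ E (gφ u₀)).hasFDerivAt).const_mul c)
  have hopt := hg.le_add_inner_of_forall_add_le hu hz hG fun w hw => by
    have := hmin w hw
    simp only [hD, inner_sub_right] at this
    linarith
  simp only [hD, inner_add_left, inner_sub_left, inner_sub_right, real_inner_smul_left]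
    at hopt ⊢
  linarith

end GradientInequalities

theorem stmt_15
    {X : Type*} [NormedAddCommGroup X] [InnerProductSpace ℝ X] [FiniteDimensional ℝ X]
    {Y : Type*} [NormedAddCommGroup Y] [InnerProductSpace ℝ Y] [FiniteDimensional ℝ Y]
    {T : Type*} [NormedAddCommGroup T] [InnerProductSpace ℝ T] [FiniteDimensional ℝ T]
    (domf : Set X) (domh : Set Y) (Θset : Set T)
    (hdomf_ne : domf.Nonempty) (hdomh_ne : domh.Nonempty)
    (hdomf_conv : Convex ℝ domf) (hdomh_conv : Convex ℝ domh)
    (f : X → ℝ) (h : Y → ℝ)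
    (hfconv : ConvexOn ℝ domf f) (hhconv : ConvexOn ℝ domh h)
    (hflsc : LowerSemicontinuousOn f domf) (hhlsc : LowerSemicontinuousOn h domh)
    (Φ : X → Y → T → ℝ) (gradxΦ : X → Y → T → X) (gradyΦ : X → Y → T → Y)
    (Lxx Lxθ Lyx Lyy Lyθ : ℝ)
    (hLxx : 0 ≤ Lxx) (hLxθ : 0 ≤ Lxθ) (hLyx : 0 ≤ Lyx) (hLyy : 0 ≤ Lyy) (hLyθ : 0 ≤ Lyθ)
    (hΦconvx : ∀ y ∈ domh, ∀ θ ∈ Θset, ConvexOn ℝ domf (fun x => Φ x y θ))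
    (hΦconcy : ∀ x ∈ domf, ∀ θ ∈ Θset, ConcaveOn ℝ domh (fun y => Φ x y θ))
    (hgradx : ∀ x ∈ domf, ∀ y ∈ domh, ∀ θ ∈ Θset,
      HasGradientAt (fun x' => Φ x' y θ) (gradxΦ x y θ) x)
    (hgrady : ∀ x ∈ domf, ∀ y ∈ domh, ∀ θ ∈ Θset,
      HasGradientAt (fun y' => Φ x y' θ) (gradyΦ x y θ) y)
    (hLipx : ∀ x ∈ domf, ∀ x' ∈ domf, ∀ y ∈ domh, ∀ θ ∈ Θset, ∀ θ' ∈ Θset,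
      ‖gradxΦ x y θ - gradxΦ x' y θ'‖ ≤ Lxx * ‖x - x'‖ + Lxθ * ‖θ - θ'‖)
    (hLipy : ∀ x ∈ domf, ∀ x' ∈ domf, ∀ y ∈ domh, ∀ y' ∈ domh, ∀ θ ∈ Θset, ∀ θ' ∈ Θset,
      ‖gradyΦ x y θ - gradyΦ x' y' θ'‖ ≤ Lyx * ‖x - x'‖ + Lyy * ‖y - y'‖ + Lyθ * ‖θ - θ'‖)
    (φX : X → ℝ) (gφX : X → X) (UX : Set X) (hUXopen : IsOpen UX) (hUXf : domf ⊆ UX)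
    (hφX : ∀ x ∈ UX, HasGradientAt φX (gφX x) x)
    (DX : X → X → ℝ)
    (hDXdef : ∀ x x', DX x x' = φX x - φX x' - ⟪gφX x', x - x'⟫)
    (hDXlb : ∀ x, ∀ x' ∈ domf, 1 / 2 * ‖x - x'‖ ^ 2 ≤ DX x x')
    (φY : Y → ℝ) (gφY : Y → Y) (UY : Set Y) (hUYopen : IsOpen UY) (hUYh : domh ⊆ UY)
    (hφY : ∀ y ∈ UY, HasGradientAt φY (gφY y) y)
    (DY : Y → Y → ℝ)
    (hDYdef : ∀ y y', DY y y' = φY y - φY y' - ⟪gφY y', y - y'⟫)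
    (hDYlb : ∀ y, ∀ y' ∈ domh, 1 / 2 * ‖y - y'‖ ^ 2 ≤ DY y y')
    (τ σ η : ℝ) (hτ : 0 < τ) (hσ : 0 < σ) (hη : 0 ≤ η)
    (xkm xk : X) (hxkm : xkm ∈ domf) (hxk : xk ∈ domf)
    (ykm yk : Y) (hykm : ykm ∈ domh) (hyk : yk ∈ domh)
    (θk θstar : T) (hθk : θk ∈ Θset) (hθstar : θstar ∈ Θset)
    (ykp : Y) (hykp : ykp ∈ domh)
    (hymin : ∀ y ∈ domh,
      h ykp
        - ⟪(1 + η) • gradyΦ xk yk θk - η • gradyΦ xkm ykm θk, ykp⟫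
        + 1 / σ * DY ykp yk
      ≤ h y
        - ⟪(1 + η) • gradyΦ xk yk θk - η • gradyΦ xkm ykm θk, y⟫
        + 1 / σ * DY y yk)
    (xkp : X) (hxkp : xkp ∈ domf)
    (hxmin : ∀ x ∈ domf,
      f xkp + ⟪gradxΦ xk ykp θk, xkp⟫ + 1 / τ * DX xkp xk
      ≤ f x + ⟪gradxΦ xk ykp θk, x⟫ + 1 / τ * DX x xk) :
    ∀ x ∈ domf, ∀ y ∈ domh,
      (f xkp + Φ xkp y θstar - h y) - (f x + Φ x ykp θstar - h ykp)
      ≤ -⟪gradyΦ xkp ykp θstar - gradyΦ xk yk θstar, ykp - y⟫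
        + η * ⟪gradyΦ xk yk θstar - gradyΦ xkm ykm θstar, ykp - y⟫
        + (2 * η + 1) * Lyθ * ‖θk - θstar‖ * ‖ykp - y‖
        + Lxθ * ‖θk - θstar‖ * ‖xkp - x‖
        + (Φ xkp ykp θstar - Φ xk ykp θstar - ⟪gradxΦ xk ykp θstar, xkp - xk⟫)
        + 1 / σ * (DY y yk - DY y ykp - DY ykp yk)
        + 1 / τ * (DX x xk - DX x xkp - DX xkp xk) := by
  intro x hx y hy
  have hy_prox := hhconv.bregman_prox_le hDYdef
    (s := -((1 + η) • gradyΦ xk yk θk - η • gradyΦ xkm ykm θk)) hykp hy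
    (hφY ykp (hUYh hykp)) fun w hw => by
      simpa only [inner_neg_left, ← sub_eq_add_neg] using hymin w hw
  have hx_prox := hfconv.bregman_prox_le hDXdef hxkp hx (hφX xkp (hUXf hxkp)) hxmin
  have hΦy := (hΦconcy xkp hxkp θstar hθstar).le_add_inner_of_hasGradientAt hykp hy
    (hgrady xkp hxkp ykp hykp θstar hθstar)
  have hΦx := (hΦconvx ykp hykp θstar hθstar).add_inner_le_of_hasGradientAt hxk hx
    (hgradx xk hxk ykp hykp θstar hθstar)
  have hx_err : ⟪gradxΦ xk ykp θstar - gradxΦ xk ykp θk, xkp - x⟫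
      ≤ Lxθ * ‖θk - θstar‖ * ‖xkp - x‖ := by
    refine (real_inner_le_norm _ _).trans ?_
    gcongr
    simpa [norm_sub_rev θstar θk] using
      hLipx xk hxk xk hxk ykp hykp θstar hθstar θk hθk
  have hy_diff : ∀ x' ∈ domf, ∀ y' ∈ domh,
      ‖gradyΦ x' y' θk - gradyΦ x' y' θstar‖ ≤ Lyθ * ‖θk - θstar‖ := fun x' hx' y' hy' => by
    simpa using hLipy x' hx' x' hx' y' hy' y' hy' θk hθk θstar hθstar
  have hy_err : ⟪gradyΦ xk yk θk - gradyΦ xk yk θstar, ykp - y⟫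
      ≤ Lyθ * ‖θk - θstar‖ * ‖ykp - y‖ :=
    (real_inner_le_norm _ _).trans (by gcongr; exact hy_diff xk hxk yk hyk)
  have hy_err_prev : -⟪gradyΦ xkm ykm θk - gradyΦ xkm ykm θstar, ykp - y⟫
      ≤ Lyθ * ‖θk - θstar‖ * ‖ykp - y‖ :=
    (neg_le_abs _).trans <| (abs_real_inner_le_norm _ _).trans
      (by gcongr; exact hy_diff xkm hxkm ykm hykm)
  have hy_err_cur := mul_le_mul_of_nonneg_left hy_err (by linarith : 0 ≤ 1 + η)
  have hy_err_prev' := mul_le_mul_of_nonneg_left hy_err_prev hη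
  simp only [inner_neg_left, inner_sub_left, inner_sub_right, real_inner_smul_left]
    at hy_prox hx_prox hΦy hΦx hx_err hy_err_cur hy_err_prev' ⊢
  linarith
end
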